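/- (Symmetry) Let ζ ∈ kˣ, let (g_1,…,g_n) be a ζ-family, let x_i ∈ A_{g_i}, and let σ ∈ S_n. Then [x_1,…,x_n] = ρ(σ,(g_1,…,g_n)) · [x_{σ(1)},…,x_{σ(n)}]. -/

import Mathlib

open Finset

/-- The set of inversions of a permutation `σ` of `Fin n`: pairs `(i,j)` with `i < j`
and `σ i > σ j`. -/
def inversions {n : ℕ} (σ : Equiv.Perm (Fin n)) : Finset (Fin n × Fin n) :=
  Finset.univ.filter fun p => p.1 < p.2 ∧ σ p.2 < σ p.1

/-- A bicharacter of an (additive) abelian group `G` with values in the units of `k`: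
a map multiplicative in each variable. -/
def IsBicharacter {k G : Type*} [CommRing k] [AddCommGroup G] (χ : G → G → kˣ) : Prop :=
  (∀ g g' h : G, χ (g + g') h = χ g h * χ g' h) ∧
    ∀ g h h' : G, χ g (h + h') = χ g h * χ g h'

/-- `(g 1, …, g n)` is a `ζ`-family: `χ(gᵢ,gⱼ)·χ(gⱼ,gᵢ) = ζ²` for all `i ≠ j`. -/
def IsZetaFamily {k G : Type*} [CommRing k] (χ : G → G → kˣ) (ζ : kˣ) {n : ℕ}
    (g : Fin n → G) : Prop :=
  ∀ i j : Fin n, i ≠ j → χ (g i) (g j) * χ (g j) (g i) = ζ ^ 2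

/-- `ρ(σ,(g 1,…,g n)) = ∏ ζ⁻¹ χ(g_{σ(j)}, g_{σ(i)})`, product over inversions of `σ`. -/
def rho {k G : Type*} [CommRing k] (χ : G → G → kˣ) (ζ : kˣ) {n : ℕ}
    (σ : Equiv.Perm (Fin n)) (g : Fin n → G) : kˣ :=
  ∏ p ∈ inversions σ, ζ⁻¹ * χ (g (σ p.2)) (g (σ p.1))

/-- The `n`-ary bracket `[x 1, …, x n] = Σ_σ ρ(σ,(g i)) x_{σ(1)} ⋯ x_{σ(n)}`. -/
def bracket {k G A : Type*} [CommRing k] [DecidableEq G] [Ring A] [Algebra k A] (χ : G → G → kˣ)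
    (ζ : kˣ) {n : ℕ} (g : Fin n → G) (x : Fin n → A) : A :=
  ∑ σ : Equiv.Perm (Fin n),
    ((rho χ ζ σ g : kˣ) : k) • (List.ofFn fun i => x (σ i)).prod

/-- Over a `ζ`-family, `ρ` is a multiplicative cocycle on the symmetric group. -/
theorem rho_mul {k G : Type*} [CommRing k] {χ : G → G → kˣ} {ζ : kˣ} {n : ℕ} {g : Fin n → G}
    (hg : IsZetaFamily χ ζ g) (σ τ : Equiv.Perm (Fin n)) :
    rho χ ζ (σ * τ) g = rho χ ζ σ g * rho χ ζ τ (fun i => g (σ i)) := by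
  have hσ : rho χ ζ σ g = ∏ p : Fin n × Fin n,
      if τ p.1 < τ p.2 ∧ σ (τ p.2) < σ (τ p.1) then
        ζ⁻¹ * χ (g (σ (τ p.2))) (g (σ (τ p.1))) else 1 := by
    rw [rho, inversions, Finset.prod_filter]
    exact (Equiv.prod_comp (Equiv.prodCongr τ τ) (fun p : Fin n × Fin n =>
      if p.1 < p.2 ∧ σ p.2 < σ p.1 then ζ⁻¹ * χ (g (σ p.2)) (g (σ p.1)) else 1)).symm
  have hinv : ∀ i j : Fin n, i ≠ j →
      (ζ⁻¹ * χ (g (σ (τ j))) (g (σ (τ i)))) * (ζ⁻¹ * χ (g (σ (τ i))) (g (σ (τ j)))) = 1 := by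
    intro i j hij
    rw [mul_mul_mul_comm, hg _ _ fun h => hij (τ.injective (σ.injective h)).symm]
    group
  rw [hσ, rho, rho, inversions, inversions, Finset.prod_filter, Finset.prod_filter,
    ← Finset.prod_mul_distrib, ← div_eq_one, ← Finset.prod_div_distrib]
  refine Finset.prod_involution (fun p _ => p.swap) ?_ ?_ (fun _ _ => Finset.mem_univ _)
    (fun p _ => p.swap_swap)
  · rintro ⟨i, j⟩ -
    simp only [Prod.swap, Equiv.Perm.mul_apply]
    rcases eq_or_ne i j with rfl | hij
    · simp
    have h := hinv i j hij
    have hτ : τ i ≠ τ j := fun h => hij (τ.injective h)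
    have hστ : σ (τ i) ≠ σ (τ j) := fun h => hτ (σ.injective h)
    rcases lt_or_gt_of_ne hij with h1 | h1 <;> rcases lt_or_gt_of_ne hτ with h2 | h2 <;>
      rcases lt_or_gt_of_ne hστ with h3 | h3 <;>
      simp only [h1, h2, h3, h1.not_gt, h2.not_gt, h3.not_gt, and_self, and_true, and_false,
        if_true, if_false, one_mul, mul_one, div_self', one_div, ← mul_inv, h,
        inv_one]
  · rintro ⟨i, j⟩ - hne heq
    obtain rfl : j = i := congrArg Prod.fst heq
    simp at hne

/-- (Symmetry) For a `ζ`-family `(g_1,…,g_n)`, homogeneous `x_i ∈ A_{g_i}` and `σ ∈ S_n`,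
`[x_1,…,x_n] = ρ(σ,(g_1,…,g_n)) · [x_{σ(1)},…,x_{σ(n)}]`. -/
theorem bracket_symmetry {k G A : Type*} [CommRing k] [IsDomain k] [AddCommGroup G]
    [DecidableEq G] [Ring A] [Algebra k A]
    (χ : G → G → kˣ) (hχ : IsBicharacter χ) (ζ : kˣ) {n : ℕ}
    (𝒜 : G → Submodule k A) (hinternal : DirectSum.IsInternal 𝒜)
    (hgmul : ∀ {a b : G} {u v : A}, u ∈ 𝒜 a → v ∈ 𝒜 b → u * v ∈ 𝒜 (a + b))
    (g : Fin n → G) (hg : IsZetaFamily χ ζ g)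
    (x : Fin n → A) (hx : ∀ i, x i ∈ 𝒜 (g i)) (σ : Equiv.Perm (Fin n)) :
    bracket χ ζ g x
      = ((rho χ ζ σ g : kˣ) : k) •
          bracket χ ζ (fun i => g (σ i)) (fun i => x (σ i)) := by
  simp only [bracket]
  rw [Finset.smul_sum, ← Equiv.sum_comp (Equiv.mulLeft σ)]
  refine Finset.sum_congr rfl fun τ _ => ?_
  rw [Equiv.coe_mulLeft, rho_mul hg, Units.val_mul, mul_smul]
  rfl
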